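/- arXiv:1905.07789 — 3 statements merged into one kernel-verified Lean document; each statement's English description precedes it below -/
import Mathlib

section
/- With the discrete variational setup below, let K ⊆ F be a finite set of facets and let y : Π v : V, E v be a discrete field such that each L_β (β ∈ K) is Fréchet-differentiable at jyβ. Then for every variation δ : Π v : V, E v, the real function t ↦ 𝕃_K(y + t·δ) = Σ_{β ∈ K} L_β(fun k => y (β k) + t • δ (β k)) has derivative at t = 0 equal to Σ_{v ∈ Cl K} μ_K(y)(v)(δ v). That is, the differential of the discrete action 𝕃_K decomposes as a sum of components, one for each vertex of the closure of K, the component at v being the discrete Noether current μ_K(y)(v). -/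
open scoped Classical

/-- The continuous linear inclusion of `E (β k)` as the `k`-th coordinate of `Π k, E (β k)`. -/
noncomputable def coordIncl {V : Type*} {n : ℕ} (E : V → Type*)
    [∀ v, NormedAddCommGroup (E v)] [∀ v, NormedSpace ℝ (E v)]
    (β : Fin (n + 1) → V) (k : Fin (n + 1)) :
    E (β k) →L[ℝ] (∀ j, E (β j)) :=
  ContinuousLinearMap.pi (Pi.single k (ContinuousLinearMap.id ℝ (E (β k))))

/-- The partial derivative `∂^{(v,β)} L (z) : E v →L[ℝ] ℝ` of a discrete Lagrangian `L` on
the facet `β` at the vertex `v`: the Fréchet derivative of `L` at `z` composed with the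
inclusion of the coordinate corresponding to `v` (and `0` if `v` is not a vertex of `β`). -/
noncomputable def dpart {V : Type*} {n : ℕ} (E : V → Type*)
    [∀ v, NormedAddCommGroup (E v)] [∀ v, NormedSpace ℝ (E v)]
    (β : Fin (n + 1) → V) (L : (∀ k, E (β k)) → ℝ) (z : ∀ k, E (β k)) (v : V) :
    E v →L[ℝ] ℝ :=
  if h : v ∈ Set.range β then
    h.choose_spec ▸ ((fderiv ℝ L z).comp (coordIncl E β h.choose))
  else 0

/-- The discrete Noether current `μ_K(y)(v) = ∑_{β ∈ K ∩ Star v} ∂^{(v,β)} L_β (jyβ)`. -/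
noncomputable def noetherCurrent {V : Type*} {n : ℕ} (E : V → Type*)
    [∀ v, NormedAddCommGroup (E v)] [∀ v, NormedSpace ℝ (E v)]
    (F : Set (Fin (n + 1) → V))
    (L : ∀ β : Fin (n + 1) → V, (∀ k, E (β k)) → ℝ)
    (K : Set (Fin (n + 1) → V)) (y : ∀ v, E v) (v : V) :
    E v →L[ℝ] ℝ :=
  ∑ᶠ β ∈ K ∩ {β ∈ F | v ∈ Set.range β}, dpart E β (L β) (fun k => y (β k)) v

theorem coordIncl_apply {V : Type*} {n : ℕ} (E : V → Type*)
    [∀ v, NormedAddCommGroup (E v)] [∀ v, NormedSpace ℝ (E v)]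
    (β : Fin (n + 1) → V) (k : Fin (n + 1)) (x : E (β k)) :
    coordIncl E β k x = Pi.single k x := by
  ext j
  by_cases h : j = k
  · subst h
    simp [coordIncl]
  · simp [coordIncl, Pi.single_eq_of_ne h]

theorem dpart_of_notMem_range {V : Type*} {n : ℕ} (E : V → Type*)
    [∀ v, NormedAddCommGroup (E v)] [∀ v, NormedSpace ℝ (E v)]
    {β : Fin (n + 1) → V} (L : (∀ k, E (β k)) → ℝ) (z : ∀ k, E (β k)) {v : V}
    (hv : v ∉ Set.range β) : dpart E β L z v = 0 :=
  dif_neg hv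

theorem dpart_of_injective {V : Type*} {n : ℕ} (E : V → Type*)
    [∀ v, NormedAddCommGroup (E v)] [∀ v, NormedSpace ℝ (E v)]
    {β : Fin (n + 1) → V} (hβ : Function.Injective β)
    (L : (∀ k, E (β k)) → ℝ) (z : ∀ k, E (β k)) (k : Fin (n + 1)) :
    dpart E β L z (β k) = (fderiv ℝ L z).comp (coordIncl E β k) := by
  have transport : ∀ (j : Fin (n + 1)) (h : β j = β k),
      (h ▸ ((fderiv ℝ L z).comp (coordIncl E β j)) : E (β k) →L[ℝ] ℝ) =
        (fderiv ℝ L z).comp (coordIncl E β k) := by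
    intro j h
    obtain rfl := hβ h
    rfl
  have hk : β k ∈ Set.range β := ⟨k, rfl⟩
  rw [dpart, dif_pos hk]
  exact transport _ hk.choose_spec

/-- The differential of a Lagrangian on a facet is the sum of its partial derivatives over
any finite set of vertices containing those of the facet. -/
theorem fderiv_eq_sum_dpart {V : Type*} {n : ℕ} (E : V → Type*)
    [∀ v, NormedAddCommGroup (E v)] [∀ v, NormedSpace ℝ (E v)]
    {β : Fin (n + 1) → V} (hβ : Function.Injective β)
    (L : (∀ k, E (β k)) → ℝ) (z : ∀ k, E (β k)) (δ : ∀ v, E v)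
    {s : Finset V} (hs : Set.range β ⊆ s) :
    fderiv ℝ L z (fun k => δ (β k)) = ∑ v ∈ s, dpart E β L z v (δ v) := by
  have himage : Finset.univ.image β ⊆ s := fun v hv => hs (by simpa using hv)
  rw [← Finset.sum_subset himage, Finset.sum_image hβ.injOn]
  · conv_lhs => rw [← Finset.univ_sum_single (fun k => δ (β k)), map_sum]
    simp [dpart_of_injective E hβ, coordIncl_apply]
  · intro v _ hv
    rw [dpart_of_notMem_range E L z (by simpa using hv), zero_apply]

theorem noetherCurrent_eq_sum {V : Type*} {n : ℕ} (E : V → Type*)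
    [∀ v, NormedAddCommGroup (E v)] [∀ v, NormedSpace ℝ (E v)]
    {F : Set (Fin (n + 1) → V)} (L : ∀ β : Fin (n + 1) → V, (∀ k, E (β k)) → ℝ)
    {K : Set (Fin (n + 1) → V)} (hKF : K ⊆ F) (hK : K.Finite) (y : ∀ v, E v) (v : V) :
    noetherCurrent E F L K y v =
      ∑ β ∈ hK.toFinset, dpart E β (L β) (fun k => y (β k)) v := by
  rw [noetherCurrent, ← finsum_mem_eq_finite_toFinset_sum _ hK]
  refine finsum_mem_inter_support_eq' _ _ _ fun β hβ => ⟨And.left, fun hβK => ⟨hβK, hKF hβK, ?_⟩⟩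
  by_contra hv
  exact hβ (dpart_of_notMem_range E (L β) _ hv)

theorem hasDerivAt_lagrangian_variation {V : Type*} {n : ℕ} (E : V → Type*)
    [∀ v, NormedAddCommGroup (E v)] [∀ v, NormedSpace ℝ (E v)]
    {β : Fin (n + 1) → V} {L : (∀ k, E (β k)) → ℝ} {z : ∀ k, E (β k)}
    (hL : DifferentiableAt ℝ L z) (w : ∀ k, E (β k)) :
    HasDerivAt (fun t : ℝ => L (fun k => z k + t • w k)) (fderiv ℝ L z w) 0 :=
  hL.hasFDerivAt.hasLineDerivAt w

/-- The differential of the discrete action `𝕃_K` decomposes as a sum over the vertices of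
the closure of `K`, the component at the vertex `v` being the discrete Noether current
`μ_K(y)(v)` applied to the variation `δ v`. -/
theorem hasDerivAt_discreteAction {V : Type*} {n : ℕ}
    (F : Set (Fin (n + 1) → V)) (hF : ∀ β ∈ F, Function.Injective β)
    (E : V → Type*) [∀ v, NormedAddCommGroup (E v)] [∀ v, NormedSpace ℝ (E v)]
    (L : ∀ β : Fin (n + 1) → V, (∀ k, E (β k)) → ℝ)
    (K : Set (Fin (n + 1) → V)) (hKF : K ⊆ F) (hK : K.Finite)
    (y : ∀ v, E v)
    (hdiff : ∀ β ∈ K, DifferentiableAt ℝ (L β) (fun k => y (β k)))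
    (δ : ∀ v, E v) :
    HasDerivAt
      (fun t : ℝ => ∑ᶠ β ∈ K, L β (fun k => y (β k) + t • δ (β k)))
      (∑ᶠ v ∈ {v : V | ∃ β ∈ K, v ∈ Set.range β},
        (noetherCurrent E F L K y v) (δ v)) 0 := by
  have hCl : {v : V | ∃ β ∈ K, v ∈ Set.range β}.Finite := by
    have h : {v : V | ∃ β ∈ K, v ∈ Set.range β} = ⋃ β ∈ K, Set.range β := by
      ext v
      simp
    rw [h]
    exact hK.biUnion fun β _ => Set.finite_range β
  simp_rw [finsum_mem_eq_finite_toFinset_sum _ hK]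
  rw [finsum_mem_eq_finite_toFinset_sum _ hCl]
  simp_rw [noetherCurrent_eq_sum E L hKF hK, sum_apply]
  rw [Finset.sum_comm]
  refine HasDerivAt.fun_sum fun β hβ => ?_
  rw [Set.Finite.mem_toFinset] at hβ
  rw [← fderiv_eq_sum_dpart E (hF β (hKF hβ)) (L β) _ δ fun v hv => by
    simpa using ⟨β, hβ, hv⟩]
  exact hasDerivAt_lagrangian_variation E (hdiff β hβ) fun k => δ (β k)
end

section
/- Discrete Euler–Lagrange equations of mechanics. Let Q be a real normed vector space, N ≥ 2 a natural number, and for each j ∈ {0, …, N−1} let L_j : Q × Q → ℝ be Fréchet-differentiable and h_j ∈ ℝ. Let q : Fin (N+1) → Q be a discrete trajectory such that for every variation δ : Fin (N+1) → Q with δ 0 = 0 and δ N = 0, the real function t ↦ Σ_{j=0}^{N−1} L_j(q_j + t • δ_j, q_{j+1} + t • δ_{j+1}) · h_j has derivative 0 at t = 0. Then for every interior index j with 1 ≤ j ≤ N−1 the discrete Euler–Lagrange equation holds: h_{j−1} • D₂L_{j−1}(q_{j−1}, q_j) + h_j • D₁L_j(q_j, q_{j+1}) = 0 as an element of Q →L[ℝ]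 ℝ, where D₁L_j(a,b) and D₂L_j(a,b) denote the partial Fréchet derivatives of L_j at (a,b) with respect to the first and second argument respectively. -/
/-- The partial Fréchet derivative of `L : Q × Q → ℝ` at `p` with respect to the first
argument, as a continuous linear functional on `Q`. -/
noncomputable def D₁ {Q : Type*} [NormedAddCommGroup Q] [NormedSpace ℝ Q]
    (L : Q × Q → ℝ) (p : Q × Q) : Q →L[ℝ] ℝ :=
  (fderiv ℝ L p).comp (ContinuousLinearMap.inl ℝ Q Q)

/-- The partial Fréchet derivative of `L : Q × Q → ℝ` at `p` with respect to the second
argument, as a continuous linear functional on `Q`. -/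
noncomputable def D₂ {Q : Type*} [NormedAddCommGroup Q] [NormedSpace ℝ Q]
    (L : Q × Q → ℝ) (p : Q × Q) : Q →L[ℝ] ℝ :=
  (fderiv ℝ L p).comp (ContinuousLinearMap.inr ℝ Q Q)

theorem fderiv_apply_eq_D₁_add_D₂ {Q : Type*} [NormedAddCommGroup Q] [NormedSpace ℝ Q]
    (L : Q × Q → ℝ) (p : Q × Q) (u v : Q) :
    fderiv ℝ L p (u, v) = D₁ L p u + D₂ L p v := by
  simp [D₁, D₂, ← map_add]

/-- The derivative of `L` along the line through `(a, b)` in the direction `(u, v)`. -/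
theorem hasDerivAt_along_line {Q : Type*} [NormedAddCommGroup Q] [NormedSpace ℝ Q]
    {L : Q × Q → ℝ} {a b : Q} (hL : DifferentiableAt ℝ L (a, b)) (u v : Q) :
    HasDerivAt (fun t : ℝ => L (a + t • u, b + t • v))
      (D₁ L (a, b) u + D₂ L (a, b) v) 0 := by
  have hline (a u : Q) : HasDerivAt (fun t : ℝ => a + t • u) u 0 := by
    simpa using ((hasDerivAt_id (0 : ℝ)).smul_const u).const_add a
  rw [← fderiv_apply_eq_D₁_add_D₂]
  refine HasFDerivAt.comp_hasDerivAt (0 : ℝ) ?_ ((hline a u).prodMk (hline b v))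
  simpa using hL.hasFDerivAt

/-- The first variation of the discrete action. -/
theorem hasDerivAt_discrete_action {Q : Type*} [NormedAddCommGroup Q] [NormedSpace ℝ Q]
    {N : ℕ} {L : Fin N → Q × Q → ℝ} (hL : ∀ j, Differentiable ℝ (L j))
    (h : Fin N → ℝ) (q δ : Fin (N + 1) → Q) :
    HasDerivAt
      (fun t : ℝ => ∑ j : Fin N,
        L j (q j.castSucc + t • δ j.castSucc, q j.succ + t • δ j.succ) * h j)
      (∑ j : Fin N, (D₁ (L j) (q j.castSucc, q j.succ) (δ j.castSucc)
        + D₂ (L j) (q j.castSucc, q j.succ) (δ j.succ)) * h j) 0 :=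
  HasDerivAt.fun_sum fun j _ =>
    (hasDerivAt_along_line (hL j _) (δ j.castSucc) (δ j.succ)).mul_const (h j)

/-- Discrete Euler–Lagrange equations of mechanics: a discrete trajectory
`q : Fin (N+1) → Q` that is critical for the discrete action
`∑ⱼ L_j(q_j, q_{j+1}) · h_j` with respect to variations vanishing at the endpoints
satisfies, at every interior index `j` (`1 ≤ j ≤ N - 1`), the discrete Euler–Lagrange
equation `h_{j-1} • D₂L_{j-1}(q_{j-1}, q_j) + h_j • D₁L_j(q_j, q_{j+1}) = 0`. -/
theorem discrete_eulerLagrange_mechanics {Q : Type*}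
    [NormedAddCommGroup Q] [NormedSpace ℝ Q]
    {N : ℕ} (hN : 2 ≤ N)
    (L : Fin N → Q × Q → ℝ) (hL : ∀ j, Differentiable ℝ (L j))
    (h : Fin N → ℝ) (q : Fin (N + 1) → Q)
    (hcrit : ∀ δ : Fin (N + 1) → Q, δ 0 = 0 → δ (Fin.last N) = 0 →
      HasDerivAt
        (fun t : ℝ => ∑ j : Fin N,
          L j (q j.castSucc + t • δ j.castSucc, q j.succ + t • δ j.succ) * h j) 0 0)
    (j : ℕ) (hj1 : 1 ≤ j) (hj2 : j ≤ N - 1) :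
    h ⟨j - 1, by omega⟩ •
        D₂ (L ⟨j - 1, by omega⟩) (q ⟨j - 1, by omega⟩, q ⟨j, by omega⟩)
      + h ⟨j, by omega⟩ •
        D₁ (L ⟨j, by omega⟩) (q ⟨j, by omega⟩, q ⟨j + 1, by omega⟩) = 0 := by
  ext v
  obtain ⟨i, rfl⟩ : ∃ i, j = i + 1 := ⟨j - 1, by omega⟩
  have hi : i + 1 < N := by omega
  let k : Fin N := ⟨i, by omega⟩
  let l : Fin N := ⟨i + 1, hi⟩
  have hkl : l.castSucc = k.succ := rfl
  have h_zero : 0 ≠ l.castSucc := hkl ▸ (Fin.succ_ne_zero k).symm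
  have hvar := (hasDerivAt_discrete_action hL h q (Pi.single l.castSucc v)).unique
    (hcrit (Pi.single l.castSucc v) (Pi.single_eq_of_ne (M := fun _ => Q) h_zero v)
      (Pi.single_eq_of_ne (M := fun _ => Q) (Fin.castSucc_lt_last l).ne' v))
  simp only [add_mul, Finset.sum_add_distrib] at hvar
  rw [Finset.sum_eq_single_of_mem l (Finset.mem_univ l), Pi.single_eq_same, hkl,
    Finset.sum_eq_single_of_mem k (Finset.mem_univ k), Pi.single_eq_same] at hvar
  · change h k * D₂ (L k) (q k.castSucc, q k.succ) v
      + h l * D₁ (L l) (q l.castSucc, q l.succ) v = 0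
    rw [hkl]
    linarith
  · intro m _ hm
    rw [Pi.single_eq_of_ne (by simpa using hm), map_zero, zero_mul]
  · intro m _ hm
    rw [Pi.single_eq_of_ne (by simpa using hm), map_zero, zero_mul]
end

section
/- Local reconstruction of a potential from an admissible reduced discrete field. Let G be a group, H a subgroup of G, n : ℕ, and let P₀, P₁, …, P_n be G-torsors (the fibers over the vertices of a facet). For each pair of indices j < k in Fin (n+1) let ψ_{jk} : P_j → P_k be an equivariant map (a discrete parallel transport along the edge (j,k)), and let q_k ⊆ P_k be an orbit of the restricted H-action (an H-structure). Assume: (flatness) ψ_{jk} ∘ ψ_{ij} = ψ_{ik} for all i < j < k; (parallelism) ψ_{jk} '' q_j = q_k (the image of the orbit q_j under ψ_{jk} equals q_k) for all j < k. Then for every p₀ ∈ q₀ there exists a section p : Π k : Fin (n+1), P_k such that p 0 = p₀, ψ_{jk} (p j) = p k for all j < k, and p k ∈ q_k for all k. In particular, every admissible H-reduced discrete field is, on the closure of a facet, induced by some discrete field of configurations. -/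
/-- Local reconstruction of a potential from an admissible reduced discrete field: given
`G`-torsors `P k` over the vertices of a facet, equivariant discrete parallel transports
`ψ j k : P j → P k` along the edges, and `H`-orbits (`H`-structures) `q k ⊆ P k`
satisfying the flatness and parallelism conditions, every point `p₀ ∈ q 0` extends to a
discrete field `p` with `p 0 = p₀`, compatible with all the parallel transports and with
values in the `H`-structures. -/
theorem reconstruction_of_potential {G : Type*} [Group G] (H : Subgroup G) {n : ℕ}
    (P : Fin (n + 1) → Type*) [∀ k, MulAction G (P k)] [∀ k, Nonempty (P k)]
    (hfree : ∀ (k : Fin (n + 1)) (g : G) (p : P k), g • p = p → g = 1)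
    (htrans : ∀ (k : Fin (n + 1)) (p q : P k), ∃ g : G, g • p = q)
    (ψ : ∀ j k : Fin (n + 1), j < k → (P j → P k))
    (hψ : ∀ (j k : Fin (n + 1)) (hjk : j < k) (g : G) (x : P j),
      ψ j k hjk (g • x) = g • ψ j k hjk x)
    (q : ∀ k, Set (P k))
    (hq : ∀ k, ∃ p : P k, q k = {x | ∃ h ∈ H, x = h • p})
    (hflat : ∀ (i j k : Fin (n + 1)) (hij : i < j) (hjk : j < k),
      (ψ j k hjk) ∘ (ψ i j hij) = ψ i k (hij.trans hjk))
    (hpar : ∀ (j k : Fin (n + 1)) (hjk : j < k), (ψ j k hjk) '' (q j) = q k)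
    (p₀ : P 0) (hp₀ : p₀ ∈ q 0) :
    ∃ p : ∀ k, P k, p 0 = p₀ ∧
      (∀ (j k : Fin (n + 1)) (hjk : j < k), ψ j k hjk (p j) = p k) ∧
      (∀ k, p k ∈ q k) := by
  refine ⟨Fin.cases p₀ fun i => ψ 0 i.succ i.succ_pos p₀, rfl, fun j k hjk => ?_, fun k => ?_⟩
  · cases k using Fin.cases with
    | zero => exact absurd hjk (Fin.not_lt_zero j)
    | succ k =>
      cases j using Fin.cases with
      | zero => rfl
      | succ j => exact congrFun (hflat 0 j.succ k.succ j.succ_pos hjk) p₀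
  · cases k using Fin.cases with
    | zero => exact hp₀
    | succ k => exact hpar 0 k.succ k.succ_pos ▸ Set.mem_image_of_mem _ hp₀
end
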